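/- The maximum number of leaves of a spanning tree of the graph C_8^2 equals 5. In particular, C_8^2 has no spanning tree with at least (2/5)·8 + 2 = 26/5 leaves, so C_8^2 is an exclusion to the bound with additive constant 2. -/

import Mathlib

open scoped Classical

/-- The number of leaves (vertices of degree 1) of a graph `T` (intended: a tree). -/
noncomputable def leafCount {V : Type*} [Fintype V] (T : SimpleGraph V) : ℕ :=
  Fintype.card {v : V // T.degree v = 1}

/-- `C_k²`, the square of the `k`-cycle: vertices `ZMod k`, with `i ~ j` iff
`i - j ≡ ±1` or `±2 (mod k)`. -/
def cycleSq (k : ℕ) : SimpleGraph (ZMod k) :=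
  SimpleGraph.fromRel (fun i j => i - j = 1 ∨ i - j = 2)

open Finset in
/-- In a graph on `8` vertices in which any two distinct vertices have a common neighbour and all
degrees are at most `4`, every spanning tree has at most `5` leaves. -/
theorem leafCount_le_five {V : Type*} [Fintype V] {G T : SimpleGraph V} (hTG : T ≤ G)
    (hV : Fintype.card V = 8) (hdeg : ∀ v, G.degree v ≤ 4)
    (hcommon : ∀ u v, u ≠ v → ∃ w, G.Adj u w ∧ G.Adj v w) (hT : T.IsTree) :
    leafCount T ≤ 5 := by
  have hsum : ∑ v, T.degree v = 14 := by
    have h₁ := T.sum_degrees_eq_twice_card_edges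
    have h₂ := hT.card_edgeFinset
    omega
  have hle (v : V) : T.degree v ≤ G.degree v := SimpleGraph.degree_le_of_le hTG
  have hcount : leafCount T = #{v | T.degree v = 1} := by
    rw [leafCount, Fintype.card_subtype]
  have hcard : #{v | T.degree v = 1} + #{v | ¬ T.degree v = 1} = 8 := by
    rw [card_filter_add_card_filter_not, card_univ, hV]
  have hsplit := sum_filter_add_sum_filter_not univ (fun v => T.degree v = 1)
    (fun v => T.degree v)
  rw [hsum, sum_congr rfl (g := fun _ => 1) (by simp), sum_const, smul_eq_mul, mul_one] at hsplit
  have hinner : ∑ v with ¬ T.degree v = 1, T.degree v ≤ #{v | ¬ T.degree v = 1} * 4 :=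
    sum_le_card_nsmul _ _ _ fun v _ => (hle v).trans (hdeg v)
  by_contra! hlt
  obtain ⟨u, v, huv, hset⟩ := card_eq_two.1 (show #{v | ¬ T.degree v = 1} = 2 by omega)
  have hleaf (w : V) (hwu : w ≠ u) (hwv : w ≠ v) : T.degree w = 1 := by
    by_contra hw
    have : w ∈ ({u, v} : Finset V) := hset ▸ by simpa using hw
    simp_all
  rw [hset, sum_pair huv] at hsplit
  rw [hset, card_pair huv] at hcard
  have hu := (hle u).trans (hdeg u)
  have hv := (hle v).trans (hdeg v)
  have hfull (x : V) (hx : T.degree x = 4) (w : V) (h : G.Adj x w) : T.Adj x w := by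
    have hsub : T.neighborFinset x ⊆ G.neighborFinset x := fun y hy => by
      simp only [SimpleGraph.mem_neighborFinset] at hy ⊢
      exact hTG hy
    have heq := eq_of_subset_of_card_le hsub (by
      simpa only [SimpleGraph.card_neighborFinset_eq_degree, hx] using hdeg x)
    rwa [← SimpleGraph.mem_neighborFinset, heq, SimpleGraph.mem_neighborFinset]
  obtain ⟨w, huw, hvw⟩ := hcommon u v huv
  have hw := hleaf w huw.ne' hvw.ne'
  obtain ⟨x, -, hx⟩ := SimpleGraph.degree_eq_one_iff_existsUnique_adj.1 hw
  exact huv ((hx u (hfull u (by omega) w huw).symm).trans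
    (hx v (hfull v (by omega) w hvw).symm).symm)

theorem cycleSq_eight_adj (i j : ZMod 8) :
    (cycleSq 8).Adj i j ↔ i - j = 1 ∨ i - j = 2 ∨ j - i = 1 ∨ j - i = 2 := by
  simp only [cycleSq, SimpleGraph.fromRel_adj]
  revert i j
  decide

theorem degree_cycleSq_eight_le (i : ZMod 8) : (cycleSq 8).degree i ≤ 4 := by
  have hsub : (cycleSq 8).neighborFinset i ⊆ {i + 1, i + 2, i - 1, i - 2} := fun j => by
    rw [SimpleGraph.mem_neighborFinset, cycleSq_eight_adj]
    revert i j
    decide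
  exact (Finset.card_le_card hsub).trans Finset.card_le_four

theorem exists_common_neighbor_cycleSq_eight (i j : ZMod 8) :
    i ≠ j → ∃ k, (cycleSq 8).Adj i k ∧ (cycleSq 8).Adj j k := by
  simp only [cycleSq_eight_adj]
  revert i j
  decide

/-- The parent map of a spanning tree of `C₈²` rooted at `0` with inner vertices
`0`, `2` and `4`. -/
def parent : ZMod 8 → ZMod 8 := ![0, 0, 0, 2, 2, 4, 0, 0]

/-- The spanning tree of `C₈²` in which every nonzero vertex is joined to its parent. -/
def fiveLeafTree : SimpleGraph (ZMod 8) :=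
  SimpleGraph.fromRel fun i j => parent i = j

instance : DecidableRel fiveLeafTree.Adj := fun i j =>
  inferInstanceAs (Decidable (i ≠ j ∧ (parent i = j ∨ parent j = i)))

theorem fiveLeafTree_le : fiveLeafTree ≤ cycleSq 8 := fun i j => by
  rw [cycleSq_eight_adj]
  revert i j
  decide

theorem fiveLeafTree_isTree : fiveLeafTree.IsTree := by
  rw [SimpleGraph.isTree_iff_connected_and_card]
  constructor
  · have hparent (i : ZMod 8) : fiveLeafTree.Reachable i (parent i) := by
      by_cases h : i = parent i
      · rw [← h]
      · exact SimpleGraph.Adj.reachable ((SimpleGraph.fromRel_adj _ _ _).2 ⟨h, Or.inl rfl⟩)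
    have hroot (i : ZMod 8) : fiveLeafTree.Reachable i 0 := by
      have h : parent (parent (parent i)) = 0 := by
        revert i
        decide
      exact h ▸ ((hparent i).trans (hparent _)).trans (hparent _)
    exact ⟨fun i j => (hroot i).trans (hroot j).symm⟩
  · have h : fiveLeafTree.edgeFinset.card = 7 := by decide
    rw [Nat.card_eq_fintype_card, Nat.card_eq_fintype_card, ← SimpleGraph.edgeFinset_card,
      ZMod.card]
    convert congrArg (· + 1) h

theorem leafCount_fiveLeafTree : leafCount fiveLeafTree = 5 := by
  have h : Fintype.card {i : ZMod 8 // fiveLeafTree.degree i = 1} = 5 := by decide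
  rw [leafCount]
  convert h

/-- The maximum number of leaves of a spanning tree of `C₈²` equals 5:
there is a spanning tree with 5 leaves, and every spanning tree has at most 5 leaves.
In particular `C₈²` has no spanning tree with at least `(2/5)·8 + 2 = 26/5` leaves. -/
theorem maxLeaves_cycleSq_eight :
    ((∃ T ≤ cycleSq 8, T.IsTree ∧ leafCount T = 5) ∧
      (∀ T ≤ cycleSq 8, T.IsTree → leafCount T ≤ 5)) ∧
    ¬ ∃ T ≤ cycleSq 8, T.IsTree ∧ (26 / 5 : ℚ) ≤ leafCount T := by
  have hle : ∀ T ≤ cycleSq 8, T.IsTree → leafCount T ≤ 5 := fun T hT htree =>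
    leafCount_le_five hT (ZMod.card 8) (fun v => by convert degree_cycleSq_eight_le v)
      exists_common_neighbor_cycleSq_eight htree
  refine ⟨⟨⟨fiveLeafTree, fiveLeafTree_le, fiveLeafTree_isTree, leafCount_fiveLeafTree⟩, hle⟩, ?_⟩
  rintro ⟨T, hT, htree, h⟩
  have h5 : (leafCount T : ℚ) ≤ 5 := by exact_mod_cast hle T hT htree
  linarith
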